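/- Let H be a finitely generated projective weak Hopf algebra with bijective antipode, with dual basis {(h_i, h_i*)}. The map f : H ⊗ H* → H* ⊗ H, f(h ⊗ h*) = h* ⊗ S^{-1}(h), is anti-multiplicative with respect to the multiplications (h ⊲⊳ h*)(k ⊲⊳ k*) = hk_{(2)} ⊲⊳ (S^{-1}(k_{(1)}) ⇀ h* ↼ k_{(3)}) * k* on H ⊗ H* and (h* ⊗ h)(k* ⊗ k) = (h_{(3)} ⇀ k* ↼ S(h_{(1)})) * h* ⊗ h_{(2)}k on H* ⊗ H. -/

import Mathlib

open TensorProduct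

structure WeakBialgebra (k H : Type*) [CommRing k] [Ring H] [Algebra k H] where
  comul : H →ₗ[k] H ⊗[k] H
  counit : H →ₗ[k] k
  coassoc : ∀ h : H, (TensorProduct.assoc k H H H) ((comul.rTensor H) (comul h)) =
      (comul.lTensor H) (comul h)
  counit_left : ∀ h : H, (TensorProduct.lid k H) ((counit.rTensor H) (comul h)) = h
  counit_right : ∀ h : H, (TensorProduct.rid k H) ((counit.lTensor H) (comul h)) = h
  comul_mul : ∀ h g : H, comul (h * g) = comul h * comul g
  weak_unit_left : (comul.lTensor H) (comul 1) =
      (Algebra.TensorProduct.map (AlgHom.id k H)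
        (Algebra.TensorProduct.includeLeft : H →ₐ[k] H ⊗[k] H)) (comul 1) *
      (Algebra.TensorProduct.includeRight : (H ⊗[k] H) →ₐ[k] H ⊗[k] (H ⊗[k] H)) (comul 1)
  weak_unit_right : (comul.lTensor H) (comul 1) =
      (Algebra.TensorProduct.includeRight : (H ⊗[k] H) →ₐ[k] H ⊗[k] (H ⊗[k] H)) (comul 1) *
      (Algebra.TensorProduct.map (AlgHom.id k H)
        (Algebra.TensorProduct.includeLeft : H →ₐ[k] H ⊗[k] H)) (comul 1)
  weak_counit₁ : ∀ h g l : H, counit (h * g * l) =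
      (LinearMap.mul' k k) ((TensorProduct.map counit counit)
        ((h ⊗ₜ[k] (1 : H)) * comul g * ((1 : H) ⊗ₜ[k] l)))
  weak_counit₂ : ∀ h g l : H, counit (h * g * l) =
      (LinearMap.mul' k k) ((TensorProduct.map counit counit)
        ((h ⊗ₜ[k] (1 : H)) * (TensorProduct.comm k H H) (comul g) * ((1 : H) ⊗ₜ[k] l)))

namespace WeakBialgebra

variable {k H : Type*} [CommRing k] [Ring H] [Algebra k H] (W : WeakBialgebra k H)

/-- The target map `ε_t(h) = ε(1_{(1)}h)1_{(2)}`. -/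
noncomputable def εt : H →ₗ[k] H :=
  (TensorProduct.lid k H).toLinearMap ∘ₗ (W.counit.rTensor H) ∘ₗ
    (LinearMap.mulLeft k (W.comul 1)) ∘ₗ
    (Algebra.TensorProduct.includeLeft : H →ₐ[k] H ⊗[k] H).toLinearMap

/-- The source map `ε_s(h) = 1_{(1)}ε(h1_{(2)})`. -/
noncomputable def εs : H →ₗ[k] H :=
  (TensorProduct.rid k H).toLinearMap ∘ₗ (W.counit.lTensor H) ∘ₗ
    (LinearMap.mulRight k (W.comul 1)) ∘ₗ
    (Algebra.TensorProduct.includeRight : H →ₐ[k] H ⊗[k] H).toLinearMap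

/-- `ε̄_t(h) = ε(h1_{(1)})1_{(2)}`. -/
noncomputable def εt' : H →ₗ[k] H :=
  (TensorProduct.lid k H).toLinearMap ∘ₗ (W.counit.rTensor H) ∘ₗ
    (LinearMap.mulRight k (W.comul 1)) ∘ₗ
    (Algebra.TensorProduct.includeLeft : H →ₐ[k] H ⊗[k] H).toLinearMap

/-- `ε̄_s(h) = ε(1_{(2)}h)1_{(1)}`. -/
noncomputable def εs' : H →ₗ[k] H :=
  (TensorProduct.rid k H).toLinearMap ∘ₗ (W.counit.lTensor H) ∘ₗ
    (LinearMap.mulLeft k (W.comul 1)) ∘ₗ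
    (Algebra.TensorProduct.includeRight : H →ₐ[k] H ⊗[k] H).toLinearMap

end WeakBialgebra

/-- A weak Hopf algebra: a weak bialgebra with an antipode. -/
structure WeakHopf (k H : Type*) [CommRing k] [Ring H] [Algebra k H] where
  W : WeakBialgebra k H
  S : H →ₗ[k] H
  S_conv_id : ∀ h : H, (LinearMap.mul' k H) ((S.rTensor H) (W.comul h)) = W.εs h
  id_conv_S : ∀ h : H, (LinearMap.mul' k H) ((S.lTensor H) (W.comul h)) = W.εt h
  S_conv_id_conv_S : ∀ h : H, (LinearMap.mul' k H) ((LinearMap.lTensor H (LinearMap.mul' k H))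
      ((TensorProduct.map S (TensorProduct.map LinearMap.id S))
        ((W.comul.lTensor H) (W.comul h)))) = S h

section DrinfeldDouble

variable {k H : Type*} [CommRing k] [Ring H] [Algebra k H]

/-- The convolution product on the dual `H* = Hom(H, k)`:
`(φ * ψ)(h) = φ(h₍₁₎)ψ(h₍₂₎)`. -/
noncomputable def dualConv (W : WeakBialgebra k H) (φ ψ : Module.Dual k H) :
    Module.Dual k H :=
  (LinearMap.mul' k k) ∘ₗ (TensorProduct.map φ ψ) ∘ₗ W.comul

/-- The map `f : H ⊗ H* → H* ⊗ H`, `f(h ⊗ h*) = h* ⊗ S⁻¹(h)`. -/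
noncomputable def doubleFlip (Sinv : H →ₗ[k] H) :
    H ⊗[k] Module.Dual k H →ₗ[k] Module.Dual k H ⊗[k] H :=
  (TensorProduct.comm k H (Module.Dual k H)).toLinearMap ∘ₗ
    (LinearMap.rTensor (Module.Dual k H) Sinv)

end DrinfeldDouble

section Convolution

variable {k C A B : Type*} [CommRing k] [AddCommGroup C] [Module k C] [Ring A] [Algebra k A]
  [Ring B] [Algebra k B]

/-- The convolution product of linear maps `C → A` with respect to a map `Δ : C → C ⊗ C`. -/
noncomputable def linearConv (Δ : C →ₗ[k] C ⊗[k] C) (f g : C →ₗ[k] A) : C →ₗ[k] A :=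
  LinearMap.mul' k A ∘ₗ TensorProduct.map f g ∘ₗ Δ

lemma linearConv_apply (Δ : C →ₗ[k] C ⊗[k] C) (f g : C →ₗ[k] A) (c : C) :
    linearConv Δ f g c = LinearMap.mul' k A (TensorProduct.map f g (Δ c)) := rfl

lemma linearConv_assoc {Δ : C →ₗ[k] C ⊗[k] C}
    (hΔ : ∀ c, TensorProduct.assoc k C C C (Δ.rTensor C (Δ c)) = Δ.lTensor C (Δ c))
    (f g l : C →ₗ[k] A) :
    linearConv Δ (linearConv Δ f g) l = linearConv Δ f (linearConv Δ g l) := by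
  ext c
  have left (x : C ⊗[k] C) : LinearMap.mul' k A (TensorProduct.map (linearConv Δ f g) l x) =
      LinearMap.mul' k A (TensorProduct.map (LinearMap.mul' k A ∘ₗ TensorProduct.map f g) l
        (Δ.rTensor C x)) := by
    induction x using TensorProduct.induction_on with
    | zero => simp
    | tmul a b => simp [linearConv_apply]
    | add x y hx hy => simp only [map_add, hx, hy]
  have right (x : C ⊗[k] C) : LinearMap.mul' k A (TensorProduct.map f (linearConv Δ g l) x) =
      LinearMap.mul' k A (TensorProduct.map f (LinearMap.mul' k A ∘ₗ TensorProduct.map g l)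
        (Δ.lTensor C x)) := by
    induction x using TensorProduct.induction_on with
    | zero => simp
    | tmul a b => simp [linearConv_apply]
    | add x y hx hy => simp only [map_add, hx, hy]
  have mul_assoc_tensor :
      LinearMap.mul' k A ∘ₗ TensorProduct.map (LinearMap.mul' k A ∘ₗ TensorProduct.map f g) l =
      LinearMap.mul' k A ∘ₗ TensorProduct.map f (LinearMap.mul' k A ∘ₗ TensorProduct.map g l) ∘ₗ
        (TensorProduct.assoc k C C C).toLinearMap := by
    ext
    simp [mul_assoc]
  rw [linearConv_apply, linearConv_apply, left, right, ← hΔ]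
  exact LinearMap.congr_fun mul_assoc_tensor _

lemma algHom_comp_linearConv (Δ : C →ₗ[k] C ⊗[k] C) (F : A →ₐ[k] B) (f g : C →ₗ[k] A) :
    F.toLinearMap ∘ₗ linearConv Δ f g =
      linearConv Δ (F.toLinearMap ∘ₗ f) (F.toLinearMap ∘ₗ g) := by
  ext c
  simp only [LinearMap.comp_apply, linearConv_apply]
  generalize Δ c = x
  induction x using TensorProduct.induction_on with
  | zero => simp
  | tmul a b => simp
  | add x y hx hy => simp only [map_add, hx, hy]

/-- Regular inverses in a convolution semigroup are unique. -/
lemma linearConv_regular_inverse_unique {Δ : C →ₗ[k] C ⊗[k] C}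
    (hΔ : ∀ c, TensorProduct.assoc k C C C (Δ.rTensor C (Δ c)) = Δ.lTensor C (Δ c))
    {f g m : C →ₗ[k] A} (hl : linearConv Δ f m = linearConv Δ g m)
    (hr : linearConv Δ m f = linearConv Δ m g)
    (hf : linearConv Δ (linearConv Δ f m) f = f) (hg : linearConv Δ (linearConv Δ g m) g = g) :
    f = g := by
  rw [← hf, hl, linearConv_assoc hΔ, hr, ← linearConv_assoc hΔ, hg]

lemma linearConv_includeLeft_includeRight (Δ : C →ₗ[k] C ⊗[k] C) (f : C →ₗ[k] A)
    (g : C →ₗ[k] B) :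
    linearConv Δ ((Algebra.TensorProduct.includeLeft : A →ₐ[k] A ⊗[k] B).toLinearMap ∘ₗ f)
      ((Algebra.TensorProduct.includeRight : B →ₐ[k] A ⊗[k] B).toLinearMap ∘ₗ g) =
      TensorProduct.map f g ∘ₗ Δ := by
  ext c
  simp only [LinearMap.comp_apply, linearConv_apply]
  generalize Δ c = x
  induction x using TensorProduct.induction_on with
  | zero => simp
  | tmul a b => simp
  | add x y hx hy => simp only [map_add, hx, hy]

lemma linearConv_includeRight_includeLeft (Δ : C →ₗ[k] C ⊗[k] C) (f : C →ₗ[k] A)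
    (g : C →ₗ[k] B) :
    linearConv Δ ((Algebra.TensorProduct.includeRight : B →ₐ[k] A ⊗[k] B).toLinearMap ∘ₗ g)
      ((Algebra.TensorProduct.includeLeft : A →ₐ[k] A ⊗[k] B).toLinearMap ∘ₗ f) =
      TensorProduct.map f g ∘ₗ (TensorProduct.comm k C C).toLinearMap ∘ₗ Δ := by
  ext c
  simp only [LinearMap.comp_apply, linearConv_apply]
  generalize Δ c = x
  induction x using TensorProduct.induction_on with
  | zero => simp
  | tmul a b => simp
  | add x y hx hy => simp only [map_add, hx, hy]

end Convolution

namespace WeakBialgebra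

variable {k H : Type*} [CommRing k] [Ring H] [Algebra k H] (W : WeakBialgebra k H)

/-- The underlying coalgebra of a weak bialgebra. -/
noncomputable abbrev toCoalgebra : Coalgebra k H where
  comul := W.comul
  counit := W.counit
  coassoc := LinearMap.ext W.coassoc
  rTensor_counit_comp_comul := LinearMap.ext fun h =>
    (TensorProduct.lid k H).injective (by simpa using W.counit_left h)
  lTensor_counit_comp_comul := LinearMap.ext fun h =>
    (TensorProduct.rid k H).injective (by simpa using W.counit_right h)

/-- The comultiplication `x ⊗ y ↦ (x₍₁₎ ⊗ y₍₁₎) ⊗ (x₍₂₎ ⊗ y₍₂₎)` on `H ⊗ H`. -/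
noncomputable def comulTensor : H ⊗[k] H →ₗ[k] (H ⊗[k] H) ⊗[k] (H ⊗[k] H) :=
  (TensorProduct.tensorTensorTensorComm k H H H H).toLinearMap ∘ₗ
    TensorProduct.map W.comul W.comul

lemma comulTensor_coassoc (x : H ⊗[k] H) :
    TensorProduct.assoc k (H ⊗[k] H) (H ⊗[k] H) (H ⊗[k] H)
      (W.comulTensor.rTensor (H ⊗[k] H) (W.comulTensor x)) =
      W.comulTensor.lTensor (H ⊗[k] H) (W.comulTensor x) := by
  let := W.toCoalgebra
  exact Coalgebra.coassoc_apply (R := k) (A := H ⊗[k] H) x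

section UnitRepresentation

variable {u : Finset (H × H)} (hu : W.comul 1 = ∑ p ∈ u, p.1 ⊗ₜ[k] p.2)

include hu

lemma εt_eq_sum (h : H) : W.εt h = ∑ p ∈ u, W.counit (p.1 * h) • p.2 := by
  simp [εt, hu, Finset.sum_mul, map_sum]

lemma εs_eq_sum (h : H) : W.εs h = ∑ p ∈ u, W.counit (h * p.2) • p.1 := by
  simp [εs, hu, Finset.mul_sum, map_sum]

lemma lTensor_comul_one :
    W.comul.lTensor H (W.comul 1) =
      ∑ p ∈ u, ∑ q ∈ u, p.1 ⊗ₜ[k] ((p.2 * q.1) ⊗ₜ[k] q.2) := by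
  rw [W.weak_unit_left, hu]
  simp [map_sum, Finset.sum_mul_sum]

lemma lTensor_comul_one' :
    W.comul.lTensor H (W.comul 1) =
      ∑ p ∈ u, ∑ q ∈ u, p.1 ⊗ₜ[k] ((q.1 * p.2) ⊗ₜ[k] q.2) := by
  rw [W.weak_unit_right, hu]
  simp only [map_sum, Finset.sum_mul_sum]
  rw [Finset.sum_comm]
  simp

end UnitRepresentation

lemma counit_εs_mul (h x : H) : W.counit (W.εs h * x) = W.counit (h * x) := by
  obtain ⟨u, hu⟩ := TensorProduct.exists_finset (W.comul 1)
  have e := W.weak_counit₂ h 1 x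
  rw [hu] at e
  simp only [mul_one] at e
  rw [e, W.εs_eq_sum hu]
  simp [map_sum, Finset.mul_sum, Finset.sum_mul]

lemma counit_mul_εt (x g : H) : W.counit (x * W.εt g) = W.counit (x * g) := by
  obtain ⟨u, hu⟩ := TensorProduct.exists_finset (W.comul 1)
  have e := W.weak_counit₂ x 1 g
  rw [hu] at e
  simp only [mul_one] at e
  rw [e, W.εt_eq_sum hu]
  simp [map_sum, Finset.mul_sum, Finset.sum_mul, mul_comm]

lemma εs_εs_mul (h g : H) : W.εs (W.εs h * g) = W.εs (h * g) := by
  obtain ⟨u, hu⟩ := TensorProduct.exists_finset (W.comul 1)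
  simp only [W.εs_eq_sum hu (_ * g), mul_assoc, W.counit_εs_mul]

lemma εt_mul_εt (h g : H) : W.εt (h * W.εt g) = W.εt (h * g) := by
  obtain ⟨u, hu⟩ := TensorProduct.exists_finset (W.comul 1)
  simp only [W.εt_eq_sum hu (h * _), ← mul_assoc, W.counit_mul_εt]

lemma rTensor_comul_one :
    W.comul.rTensor H (W.comul 1) =
      (TensorProduct.assoc k H H H).symm (W.comul.lTensor H (W.comul 1)) :=
  (LinearEquiv.eq_symm_apply _).2 (W.coassoc 1)

lemma comul_εs (h : H) : W.comul (W.εs h) = (1 ⊗ₜ[k] W.εs h) * W.comul 1 := by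
  obtain ⟨u, hu⟩ := TensorProduct.exists_finset (W.comul 1)
  have e := W.rTensor_comul_one
  rw [W.lTensor_comul_one' hu, hu] at e
  have e' := congrArg (TensorProduct.rid k (H ⊗[k] H) ∘
    (W.counit ∘ₗ LinearMap.mulLeft k h).lTensor (H ⊗[k] H)) e
  rw [W.εs_eq_sum hu, hu]
  simp only [map_sum, Function.comp_apply, LinearMap.rTensor_tmul, LinearMap.lTensor_tmul,
    TensorProduct.assoc_symm_tmul, LinearMap.comp_apply, LinearMap.mulLeft_apply,
    TensorProduct.rid_tmul] at e'
  simp only [map_sum, map_smul, e', TensorProduct.tmul_sum, Finset.sum_mul, Finset.mul_sum,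
    Algebra.TensorProduct.tmul_mul_tmul, one_mul, TensorProduct.tmul_smul, smul_mul_assoc]

lemma comul_εt (h : H) : W.comul (W.εt h) = W.comul 1 * (W.εt h ⊗ₜ[k] 1) := by
  obtain ⟨u, hu⟩ := TensorProduct.exists_finset (W.comul 1)
  have e := W.lTensor_comul_one' hu
  rw [hu] at e
  have e' := congrArg (TensorProduct.lid k (H ⊗[k] H) ∘
    (W.counit ∘ₗ LinearMap.mulRight k h).rTensor (H ⊗[k] H)) e
  rw [W.εt_eq_sum hu, hu]
  simp only [map_sum, Function.comp_apply, LinearMap.rTensor_tmul, LinearMap.lTensor_tmul,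
    LinearMap.comp_apply, LinearMap.mulRight_apply, TensorProduct.lid_tmul] at e'
  simp only [map_sum, map_smul, e', TensorProduct.sum_tmul, Finset.sum_mul, Finset.mul_sum,
    Algebra.TensorProduct.tmul_mul_tmul, mul_one, TensorProduct.smul_tmul', mul_smul_comm]

lemma comul_εs_mul (h g : H) : W.comul (W.εs h * g) = (1 ⊗ₜ[k] W.εs h) * W.comul g := by
  rw [W.comul_mul, comul_εs, mul_assoc, ← W.comul_mul, one_mul]

lemma comul_mul_εt (h g : H) : W.comul (h * W.εt g) = W.comul h * (W.εt g ⊗ₜ[k] 1) := by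
  rw [W.comul_mul, comul_εt, ← mul_assoc, ← W.comul_mul, mul_one]

lemma εs_mul_εt_comm (h g : H) : W.εs h * W.εt g = W.εt g * W.εs h := by
  obtain ⟨u, hu⟩ := TensorProduct.exists_finset (W.comul 1)
  have e := (W.lTensor_comul_one' hu).symm.trans (W.lTensor_comul_one hu)
  have e' := congrArg (TensorProduct.lid k H ∘
    TensorProduct.map (W.counit ∘ₗ LinearMap.mulRight k g) (TensorProduct.rid k H ∘ₗ
      (W.counit ∘ₗ LinearMap.mulLeft k h).lTensor H)) e
  simp only [map_sum, Function.comp_apply, TensorProduct.map_tmul, LinearMap.lTensor_tmul,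
    LinearMap.comp_apply, LinearMap.mulRight_apply, LinearMap.mulLeft_apply,
    LinearEquiv.coe_coe, TensorProduct.rid_tmul, TensorProduct.lid_tmul] at e'
  rw [W.εs_eq_sum hu, W.εt_eq_sum hu, Finset.sum_mul_sum, Finset.sum_mul_sum, Finset.sum_comm]
  simp only [smul_mul_assoc, mul_smul_comm]
  exact e'.trans (Finset.sum_congr rfl fun _ _ => Finset.sum_congr rfl fun _ _ =>
    smul_comm _ _ _)

lemma lTensor_εt_comul (h : H) :
    W.εt.lTensor H (W.comul h) = W.comul 1 * (h ⊗ₜ[k] 1) := by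
  obtain ⟨u, hu⟩ := TensorProduct.exists_finset (W.comul 1)
  have e := W.rTensor_comul_one
  rw [W.lTensor_comul_one' hu, hu] at e
  have e' := congrArg (((TensorProduct.rid k H).toLinearMap ∘ₗ W.counit.lTensor H ∘ₗ
    LinearMap.mulRight k (W.comul h)).rTensor H) e
  simp only [map_sum, LinearMap.rTensor_tmul, TensorProduct.assoc_symm_tmul,
    LinearMap.comp_apply, LinearMap.mulRight_apply, LinearEquiv.coe_coe, ← W.comul_mul,
    W.counit_right] at e'
  rw [hu, Finset.sum_mul]
  simp only [Algebra.TensorProduct.tmul_mul_tmul, mul_one, e']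
  rw [Finset.sum_comm]
  have key (p : H × H) : ∑ q ∈ u, (TensorProduct.rid k H) (W.counit.lTensor H
      ((q.1 ⊗ₜ[k] (p.1 * q.2)) * W.comul h)) ⊗ₜ[k] p.2 =
      (TensorProduct.rid k H) (W.counit.lTensor H ((1 ⊗ₜ[k] p.1) * W.comul h)) ⊗ₜ[k] p.2 := by
    have hc : W.comul 1 * W.comul h = W.comul h := by rw [← W.comul_mul, one_mul]
    conv_rhs => rw [← hc, ← mul_assoc, hu, Finset.mul_sum, Finset.sum_mul]
    simp [map_sum, TensorProduct.sum_tmul]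
  simp only [key]
  generalize W.comul h = x
  induction x using TensorProduct.induction_on with
  | zero => simp
  | tmul a b => simp [W.εt_eq_sum hu, TensorProduct.tmul_sum, TensorProduct.smul_tmul]
  | add x y hx hy =>
    simp only [map_add, mul_add, TensorProduct.add_tmul, Finset.sum_add_distrib, hx, hy]

lemma rTensor_εs_comul (h : H) :
    W.εs.rTensor H (W.comul h) = (1 ⊗ₜ[k] h) * W.comul 1 := by
  obtain ⟨u, hu⟩ := TensorProduct.exists_finset (W.comul 1)
  have e := W.lTensor_comul_one' hu
  rw [hu] at e
  have e' := congrArg (((TensorProduct.lid k H).toLinearMap ∘ₗ W.counit.rTensor H ∘ₗ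
    LinearMap.mulLeft k (W.comul h)).lTensor H) e
  simp only [map_sum, LinearMap.lTensor_tmul,
    LinearMap.comp_apply, LinearMap.mulLeft_apply, LinearEquiv.coe_coe, ← W.comul_mul,
    W.counit_left] at e'
  rw [hu, Finset.mul_sum]
  simp only [Algebra.TensorProduct.tmul_mul_tmul, one_mul, e']
  have key (p : H × H) : ∑ q ∈ u, p.1 ⊗ₜ[k] (TensorProduct.lid k H) (W.counit.rTensor H
      (W.comul h * ((q.1 * p.2) ⊗ₜ[k] q.2))) =
      p.1 ⊗ₜ[k] (TensorProduct.lid k H)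
        (W.counit.rTensor H (W.comul h * (p.2 ⊗ₜ[k] 1))) := by
    have hc : W.comul h * W.comul 1 = W.comul h := by rw [← W.comul_mul, mul_one]
    conv_rhs => rw [← hc, mul_assoc, hu, Finset.sum_mul, Finset.mul_sum]
    simp [map_sum, TensorProduct.tmul_sum]
  simp only [key]
  generalize W.comul h = x
  induction x using TensorProduct.induction_on with
  | zero => simp
  | tmul a b => simp [W.εs_eq_sum hu, TensorProduct.sum_tmul, TensorProduct.smul_tmul]
  | add x y hx hy =>
    simp only [map_add, add_mul, TensorProduct.tmul_add, Finset.sum_add_distrib, hx, hy]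

lemma map_εs_εt_comul (h : H) :
    TensorProduct.map W.εs W.εt (W.comul h) =
      TensorProduct.map W.εs W.εt (TensorProduct.comm k H H (W.comul h)) := by
  obtain ⟨u, hu⟩ := TensorProduct.exists_finset (W.comul 1)
  have expand (x : H ⊗[k] H) : TensorProduct.map W.εs W.εt x = ∑ p ∈ u, ∑ q ∈ u,
      LinearMap.mul' k k (TensorProduct.map W.counit W.counit
        ((p.1 ⊗ₜ[k] (1 : H)) * TensorProduct.comm k H H x * ((1 : H) ⊗ₜ[k] q.2))) •
          (q.1 ⊗ₜ[k] p.2) := by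
    induction x using TensorProduct.induction_on with
    | zero => simp
    | tmul a b =>
      rw [TensorProduct.map_tmul, W.εs_eq_sum hu, W.εt_eq_sum hu]
      simp [TensorProduct.tmul_sum, TensorProduct.sum_tmul, TensorProduct.smul_tmul', smul_smul,
        Finset.smul_sum]
    | add x y hx hy =>
      simp only [map_add, mul_add, add_mul, add_smul, Finset.sum_add_distrib, hx, hy]
  rw [expand, expand]
  simp only [← W.weak_counit₂, TensorProduct.comm_comm, ← W.weak_counit₁]

end WeakBialgebra

namespace WeakHopf

variable {k H : Type*} [CommRing k] [Ring H] [Algebra k H] (WH : WeakHopf k H)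

lemma linearConv_antipode_id : linearConv WH.W.comul WH.S LinearMap.id = WH.W.εs :=
  LinearMap.ext WH.S_conv_id

lemma linearConv_id_antipode : linearConv WH.W.comul LinearMap.id WH.S = WH.W.εt :=
  LinearMap.ext WH.id_conv_S

lemma linearConv_antipode_εt : linearConv WH.W.comul WH.S WH.W.εt = WH.S := by
  ext h
  rw [← linearConv_id_antipode]
  refine Eq.trans ?_ (WH.S_conv_id_conv_S h)
  rw [linearConv_apply]
  generalize WH.W.comul h = x
  induction x using TensorProduct.induction_on with
  | zero => simp
  | tmul a b => simp [linearConv_apply]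
  | add x y hx hy => simp only [map_add, hx, hy]

lemma linearConv_εs_antipode : linearConv WH.W.comul WH.W.εs WH.S = WH.S := by
  rw [← linearConv_antipode_id, linearConv_assoc WH.W.coassoc, linearConv_id_antipode,
    linearConv_antipode_εt]

lemma linearConv_comulTensor_comp_mul (f g : H →ₗ[k] H) :
    linearConv WH.W.comulTensor (f ∘ₗ LinearMap.mul' k H) (g ∘ₗ LinearMap.mul' k H) =
      linearConv WH.W.comul f g ∘ₗ LinearMap.mul' k H := by
  ext x y
  simp only [linearConv_apply, WeakBialgebra.comulTensor, LinearMap.comp_apply,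
    TensorProduct.AlgebraTensorModule.curry_apply, TensorProduct.curry_apply,
    LinearMap.coe_restrictScalars, LinearMap.mul'_apply, TensorProduct.map_tmul,
    LinearEquiv.coe_coe, WH.W.comul_mul]
  generalize WH.W.comul x = X
  generalize WH.W.comul y = Y
  induction X using TensorProduct.induction_on with
  | zero => simp
  | add X X' hX hX' => simp only [map_add, TensorProduct.add_tmul, add_mul, hX, hX']
  | tmul a b =>
    induction Y using TensorProduct.induction_on with
    | zero => simp
    | add Y Y' hY hY' => simp only [map_add, TensorProduct.tmul_add, mul_add, hY, hY']
    | tmul c d => simp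

/-- The map `x ⊗ y ↦ S(y)S(x)`. -/
noncomputable def antipodeMulOp : H ⊗[k] H →ₗ[k] H :=
  LinearMap.mul' k H ∘ₗ TensorProduct.map WH.S WH.S ∘ₗ (TensorProduct.comm k H H).toLinearMap

@[simp]
lemma antipodeMulOp_tmul (x y : H) : WH.antipodeMulOp (x ⊗ₜ[k] y) = WH.S y * WH.S x := by
  simp [antipodeMulOp]

lemma linearConv_antipodeMulOp_mul_tmul (x y : H) :
    linearConv WH.W.comulTensor WH.antipodeMulOp (LinearMap.mul' k H) (x ⊗ₜ[k] y) =
      LinearMap.mul' k H (TensorProduct.map WH.S LinearMap.id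
        ((1 ⊗ₜ[k] WH.W.εs x) * WH.W.comul y)) := by
  rw [← WH.S_conv_id, linearConv_apply, WeakBialgebra.comulTensor, LinearMap.comp_apply,
    TensorProduct.map_tmul]
  generalize WH.W.comul x = X
  generalize WH.W.comul y = Y
  induction X using TensorProduct.induction_on with
  | zero => simp
  | add X X' hX hX' => simp only [map_add, TensorProduct.add_tmul, TensorProduct.tmul_add,
      add_mul, hX, hX']
  | tmul a b =>
    induction Y using TensorProduct.induction_on with
    | zero => simp
    | add Y Y' hY hY' => simp only [map_add, TensorProduct.tmul_add, mul_add, hY, hY']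
    | tmul c d => simp [mul_assoc]

lemma linearConv_mul_antipodeMulOp_tmul (x y : H) :
    linearConv WH.W.comulTensor (LinearMap.mul' k H) WH.antipodeMulOp (x ⊗ₜ[k] y) =
      LinearMap.mul' k H (TensorProduct.map LinearMap.id WH.S
        (WH.W.comul x * (WH.W.εt y ⊗ₜ[k] 1))) := by
  rw [← WH.id_conv_S, linearConv_apply, WeakBialgebra.comulTensor, LinearMap.comp_apply,
    TensorProduct.map_tmul]
  generalize WH.W.comul x = X
  generalize WH.W.comul y = Y
  induction Y using TensorProduct.induction_on with
  | zero => simp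
  | add Y Y' hY hY' => simp only [map_add, TensorProduct.add_tmul, TensorProduct.tmul_add,
      mul_add, hY, hY']
  | tmul c d =>
    induction X using TensorProduct.induction_on with
    | zero => simp
    | add X X' hX hX' => simp only [map_add, TensorProduct.add_tmul, add_mul, hX, hX']
    | tmul a b => simp [mul_assoc]

lemma linearConv_antipodeMulOp_mul :
    linearConv WH.W.comulTensor WH.antipodeMulOp (LinearMap.mul' k H) =
      WH.W.εs ∘ₗ LinearMap.mul' k H := by
  ext x y
  refine (WH.linearConv_antipodeMulOp_mul_tmul x y).trans ?_
  rw [← WeakBialgebra.comul_εs_mul]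
  exact (WH.S_conv_id _).trans (WH.W.εs_εs_mul x y)

lemma linearConv_mul_antipodeMulOp :
    linearConv WH.W.comulTensor (LinearMap.mul' k H) WH.antipodeMulOp =
      WH.W.εt ∘ₗ LinearMap.mul' k H := by
  ext x y
  refine (WH.linearConv_mul_antipodeMulOp_tmul x y).trans ?_
  rw [← WeakBialgebra.comul_mul_εt]
  exact (WH.id_conv_S _).trans (WH.W.εt_mul_εt x y)

lemma linearConv_antipode_mulLeft_εs_antipode (x : H) :
    linearConv WH.W.comul (linearConv WH.W.comul WH.S (LinearMap.mulLeft k (WH.W.εs x))) WH.S =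
      LinearMap.mulRight k (WH.W.εs x) ∘ₗ WH.S := by
  have hl : linearConv WH.W.comul (LinearMap.mulLeft k (WH.W.εs x)) WH.S =
      LinearMap.mulRight k (WH.W.εs x) ∘ₗ WH.W.εt := by
    ext h
    refine Eq.trans ?_ (WH.W.εs_mul_εt_comm x h)
    rw [← WH.id_conv_S, linearConv_apply]
    generalize WH.W.comul h = X
    induction X using TensorProduct.induction_on with
    | zero => simp
    | add X X' hX hX' => simp only [map_add, mul_add, hX, hX']
    | tmul a b => simp [mul_assoc]
  rw [linearConv_assoc WH.W.coassoc, hl]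
  ext h
  conv_rhs => rw [← WH.linearConv_antipode_εt]
  rw [LinearMap.comp_apply, linearConv_apply, linearConv_apply]
  generalize WH.W.comul h = X
  induction X using TensorProduct.induction_on with
  | zero => simp
  | add X X' hX hX' => simp only [map_add, hX, hX']
  | tmul a b => simp [mul_assoc]

lemma linearConv_antipodeMulOp_mul_antipodeMulOp :
    linearConv WH.W.comulTensor
      (linearConv WH.W.comulTensor WH.antipodeMulOp (LinearMap.mul' k H)) WH.antipodeMulOp =
      WH.antipodeMulOp := by
  have inner (a y : H) :
      linearConv WH.W.comulTensor WH.antipodeMulOp (LinearMap.mul' k H) (a ⊗ₜ[k] y) =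
        linearConv WH.W.comul WH.S (LinearMap.mulLeft k (WH.W.εs a)) y := by
    rw [linearConv_antipodeMulOp_mul_tmul, linearConv_apply]
    generalize WH.W.comul y = Y
    induction Y using TensorProduct.induction_on with
    | zero => simp
    | add Y Y' hY hY' => simp only [map_add, mul_add, hY, hY']
    | tmul c d => simp
  have outer (a b y : H) :
      LinearMap.mul' k H (TensorProduct.map
        (linearConv WH.W.comulTensor WH.antipodeMulOp (LinearMap.mul' k H)) WH.antipodeMulOp
        (TensorProduct.tensorTensorTensorComm k H H H H ((a ⊗ₜ[k] b) ⊗ₜ[k] WH.W.comul y))) =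
      WH.S y * (WH.W.εs a * WH.S b) := by
    have e := LinearMap.congr_fun (WH.linearConv_antipode_mulLeft_εs_antipode a) y
    rw [LinearMap.comp_apply, LinearMap.mulRight_apply] at e
    rw [← mul_assoc, ← e, linearConv_apply]
    generalize WH.W.comul y = Y
    induction Y using TensorProduct.induction_on with
    | zero => simp
    | add Y Y' hY hY' => simp only [map_add, TensorProduct.tmul_add, add_mul, hY, hY']
    | tmul c d => simp [inner, mul_assoc]
  ext x y
  refine Eq.trans ?_ (WH.antipodeMulOp_tmul x y).symm
  have hx : WH.S x = LinearMap.mul' k H (TensorProduct.map WH.W.εs WH.S (WH.W.comul x)) :=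
    (LinearMap.congr_fun WH.linearConv_εs_antipode x).symm
  change LinearMap.mul' k H (TensorProduct.map _ _
    (TensorProduct.tensorTensorTensorComm k H H H H (WH.W.comul x ⊗ₜ[k] WH.W.comul y))) = _
  rw [hx]
  generalize WH.W.comul x = X
  induction X using TensorProduct.induction_on with
  | zero => simp
  | add X X' hX hX' => simp only [map_add, TensorProduct.add_tmul, mul_add, hX, hX']
  | tmul a b => simp [outer]

/-- The antipode of a weak Hopf algebra is anti-multiplicative. -/
theorem antipode_mul (x y : H) : WH.S (x * y) = WH.S y * WH.S x := by
  have e : WH.S ∘ₗ LinearMap.mul' k H = WH.antipodeMulOp := by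
    refine linearConv_regular_inverse_unique (m := LinearMap.mul' k H)
      WH.W.comulTensor_coassoc ?_ ?_ ?_ WH.linearConv_antipodeMulOp_mul_antipodeMulOp
    · rw [linearConv_antipodeMulOp_mul, ← linearConv_antipode_id]
      exact WH.linearConv_comulTensor_comp_mul WH.S LinearMap.id
    · rw [linearConv_mul_antipodeMulOp, ← linearConv_id_antipode]
      exact WH.linearConv_comulTensor_comp_mul LinearMap.id WH.S
    · have h := WH.linearConv_comulTensor_comp_mul WH.S LinearMap.id
      rw [LinearMap.id_comp] at h
      rw [h, linearConv_comulTensor_comp_mul, linearConv_antipode_id, linearConv_εs_antipode]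
  simpa using LinearMap.congr_fun e (x ⊗ₜ[k] y)

/-- The embedding `f ↦ f(-) ⊗ 1` of linear maps. -/
noncomputable abbrev tensorOne (f : H →ₗ[k] H) : H →ₗ[k] H ⊗[k] H :=
  (Algebra.TensorProduct.includeLeft : H →ₐ[k] H ⊗[k] H).toLinearMap ∘ₗ f

/-- The embedding `f ↦ 1 ⊗ f(-)` of linear maps. -/
noncomputable abbrev oneTensor (f : H →ₗ[k] H) : H →ₗ[k] H ⊗[k] H :=
  (Algebra.TensorProduct.includeRight : H →ₐ[k] H ⊗[k] H).toLinearMap ∘ₗ f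

lemma linearConv_tensorOne_oneTensor_id :
    linearConv WH.W.comul (tensorOne LinearMap.id) (oneTensor LinearMap.id) = WH.W.comul := by
  rw [linearConv_includeLeft_includeRight, TensorProduct.map_id, LinearMap.id_comp]

/-- The map `h ↦ S(h₍₂₎) ⊗ S(h₍₁₎)`. -/
noncomputable def antipodeComulOp : H →ₗ[k] H ⊗[k] H :=
  TensorProduct.map WH.S WH.S ∘ₗ (TensorProduct.comm k H H).toLinearMap ∘ₗ WH.W.comul

lemma antipodeComulOp_eq_linearConv :
    WH.antipodeComulOp = linearConv WH.W.comul (oneTensor WH.S) (tensorOne WH.S) :=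
  (linearConv_includeRight_includeLeft ..).symm

lemma linearConv_antipodeComulOp_comul_eq :
    linearConv WH.W.comul WH.antipodeComulOp WH.W.comul =
      linearConv WH.W.comul (oneTensor WH.S)
        (linearConv WH.W.comul (tensorOne WH.W.εs) (oneTensor LinearMap.id)) := by
  have key (X : H →ₗ[k] H ⊗[k] H)
      (hX : X = linearConv WH.W.comul (tensorOne LinearMap.id) (oneTensor LinearMap.id)) :
      linearConv WH.W.comul WH.antipodeComulOp X =
        linearConv WH.W.comul (oneTensor WH.S)
          (linearConv WH.W.comul (tensorOne WH.W.εs) (oneTensor LinearMap.id)) := by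
    rw [hX, antipodeComulOp_eq_linearConv, linearConv_assoc WH.W.coassoc,
      ← linearConv_assoc WH.W.coassoc (tensorOne WH.S), ← algHom_comp_linearConv,
      linearConv_antipode_id]
  exact key _ WH.linearConv_tensorOne_oneTensor_id.symm

lemma linearConv_antipodeComulOp_comul :
    linearConv WH.W.comul WH.antipodeComulOp WH.W.comul = WH.W.comul ∘ₗ WH.W.εs := by
  rw [linearConv_antipodeComulOp_comul_eq, linearConv_includeLeft_includeRight]
  ext h
  rw [LinearMap.comp_apply, WH.W.comul_εs, ← WH.S_conv_id, linearConv_apply]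
  have e (z : H) : (TensorProduct.map WH.W.εs LinearMap.id ∘ₗ WH.W.comul) z =
    (1 ⊗ₜ[k] z) * WH.W.comul 1 := WH.W.rTensor_εs_comul z
  generalize WH.W.comul h = X
  induction X using TensorProduct.induction_on with
  | zero => simp
  | add X X' hX hX' => simp only [map_add, TensorProduct.tmul_add, add_mul, hX, hX']
  | tmul a b =>
    rw [TensorProduct.map_tmul, e]
    simp [← mul_assoc]

lemma linearConv_comul_antipodeComulOp :
    linearConv WH.W.comul WH.W.comul WH.antipodeComulOp = WH.W.comul ∘ₗ WH.W.εt := by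
  have key (X : H →ₗ[k] H ⊗[k] H)
      (hX : X = linearConv WH.W.comul (tensorOne LinearMap.id) (oneTensor LinearMap.id)) :
      linearConv WH.W.comul X WH.antipodeComulOp =
        linearConv WH.W.comul
          (linearConv WH.W.comul (tensorOne LinearMap.id) (oneTensor WH.W.εt))
          (tensorOne WH.S) := by
    rw [hX, antipodeComulOp_eq_linearConv, ← linearConv_assoc WH.W.coassoc,
      linearConv_assoc WH.W.coassoc (tensorOne LinearMap.id), ← algHom_comp_linearConv,
      linearConv_id_antipode]
  rw [key _ WH.linearConv_tensorOne_oneTensor_id.symm, linearConv_includeLeft_includeRight]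
  ext h
  rw [LinearMap.comp_apply, WH.W.comul_εt, ← WH.id_conv_S, linearConv_apply]
  have e (z : H) : (TensorProduct.map LinearMap.id WH.W.εt ∘ₗ WH.W.comul) z =
    WH.W.comul 1 * (z ⊗ₜ[k] 1) := WH.W.lTensor_εt_comul z
  generalize WH.W.comul h = X
  induction X using TensorProduct.induction_on with
  | zero => simp
  | add X X' hX hX' => simp only [map_add, TensorProduct.add_tmul, mul_add, hX, hX']
  | tmul a b =>
    rw [TensorProduct.map_tmul, e]
    simp [mul_assoc]

lemma linearConv_εs_εt_comm :
    linearConv WH.W.comul (tensorOne WH.W.εs) (oneTensor WH.W.εt) =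
      linearConv WH.W.comul (oneTensor WH.W.εt) (tensorOne WH.W.εs) := by
  rw [linearConv_includeLeft_includeRight, linearConv_includeRight_includeLeft]
  exact LinearMap.ext WH.W.map_εs_εt_comul

lemma linearConv_antipodeComulOp_comul_antipodeComulOp :
    linearConv WH.W.comul (linearConv WH.W.comul WH.antipodeComulOp WH.W.comul)
      WH.antipodeComulOp = WH.antipodeComulOp := by
  have hc := WH.W.coassoc
  rw [linearConv_antipodeComulOp_comul_eq, antipodeComulOp_eq_linearConv,
    linearConv_assoc hc, linearConv_assoc hc (tensorOne WH.W.εs),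
    ← linearConv_assoc hc (oneTensor LinearMap.id), ← algHom_comp_linearConv,
    linearConv_id_antipode, ← linearConv_assoc hc (tensorOne WH.W.εs), linearConv_εs_εt_comm,
    linearConv_assoc hc (oneTensor WH.W.εt), ← algHom_comp_linearConv, linearConv_εs_antipode,
    ← linearConv_assoc hc (oneTensor WH.S), ← algHom_comp_linearConv, linearConv_antipode_εt]

lemma linearConv_comul_comp (f g : H →ₗ[k] H) :
    linearConv WH.W.comul (WH.W.comul ∘ₗ f) (WH.W.comul ∘ₗ g) =
      WH.W.comul ∘ₗ linearConv WH.W.comul f g := by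
  ext h
  simp only [LinearMap.comp_apply, linearConv_apply]
  generalize WH.W.comul h = X
  induction X using TensorProduct.induction_on with
  | zero => simp
  | add X X' hX hX' => simp only [map_add, hX, hX']
  | tmul a b => simp [WH.W.comul_mul]

/-- The antipode of a weak Hopf algebra is anti-comultiplicative. -/
theorem comul_antipode (h : H) : WH.W.comul (WH.S h) =
    TensorProduct.map WH.S WH.S (TensorProduct.comm k H H (WH.W.comul h)) := by
  have e : WH.W.comul ∘ₗ WH.S = WH.antipodeComulOp := by
    have hl := WH.linearConv_comul_comp WH.S LinearMap.id
    have hr := WH.linearConv_comul_comp LinearMap.id WH.S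
    rw [LinearMap.comp_id] at hl hr
    refine linearConv_regular_inverse_unique (m := WH.W.comul) WH.W.coassoc ?_ ?_ ?_
      WH.linearConv_antipodeComulOp_comul_antipodeComulOp
    · rw [hl, linearConv_antipodeComulOp_comul, linearConv_antipode_id]
    · rw [hr, linearConv_comul_antipodeComulOp, linearConv_id_antipode]
    · rw [hl, linearConv_comul_comp, linearConv_antipode_id, linearConv_εs_antipode]
  exact LinearMap.congr_fun e h

section InverseAntipode

variable {Sinv : H →ₗ[k] H} (hSinv₁ : ∀ h : H, Sinv (WH.S h) = h)
  (hSinv₂ : ∀ h : H, WH.S (Sinv h) = h)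

include hSinv₁ hSinv₂

lemma antipodeInv_mul (x y : H) : Sinv (x * y) = Sinv y * Sinv x := by
  conv_lhs => rw [← hSinv₂ x, ← hSinv₂ y, ← WH.antipode_mul, hSinv₁]

lemma comul_antipodeInv (h : H) : WH.W.comul (Sinv h) =
    TensorProduct.map Sinv Sinv (TensorProduct.comm k H H (WH.W.comul h)) := by
  have inv (X : H ⊗[k] H) : TensorProduct.map Sinv Sinv (TensorProduct.comm k H H
      (TensorProduct.map WH.S WH.S (TensorProduct.comm k H H X))) = X := by
    induction X using TensorProduct.induction_on with
    | zero => simp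
    | add X X' hX hX' => simp only [map_add, hX, hX']
    | tmul a b => simp [hSinv₁]
  conv_rhs => rw [← hSinv₂ h, WH.comul_antipode, inv]

lemma rTensor_comul_comul_antipodeInv {ι : Type*} {s : Finset ι} {a b c : ι → H} {g : H}
    (hg : WH.W.comul.rTensor H (WH.W.comul g) = ∑ i ∈ s, (a i ⊗ₜ[k] b i) ⊗ₜ[k] c i) :
    WH.W.comul.rTensor H (WH.W.comul (Sinv g)) =
      ∑ i ∈ s, (Sinv (c i) ⊗ₜ[k] Sinv (b i)) ⊗ₜ[k] Sinv (a i) := by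
  have hg' := (WH.W.coassoc g).symm
  rw [hg] at hg'
  simp only [map_sum, TensorProduct.assoc_tmul] at hg'
  have flip (X : H ⊗[k] H) : WH.W.comul.rTensor H
      (TensorProduct.map Sinv Sinv (TensorProduct.comm k H H X)) =
      TensorProduct.map (TensorProduct.map Sinv Sinv ∘ₗ (TensorProduct.comm k H H).toLinearMap)
        Sinv (TensorProduct.comm k H (H ⊗[k] H) (WH.W.comul.lTensor H X)) := by
    induction X using TensorProduct.induction_on with
    | zero => simp
    | add X X' hX hX' => simp only [map_add, hX, hX']
    | tmul a b => simp [WH.comul_antipodeInv hSinv₁ hSinv₂]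
  rw [WH.comul_antipodeInv hSinv₁ hSinv₂, flip, hg']
  simp [map_sum]

end InverseAntipode

/-- The map `(x ⊗ y) ⊗ z ↦ (z ⇀ φ ↼ S(x)) * ψ ⊗ yh`. -/
noncomputable def dualTwistMul (φ ψ : Module.Dual k H) (h : H) :
    (H ⊗[k] H) ⊗[k] H →ₗ[k] Module.Dual k H ⊗[k] H :=
  TensorProduct.map
    (TensorProduct.lift (LinearMap.mk₂ k
      (fun x z => dualConv WH.W
        (φ ∘ₗ LinearMap.mul k H (WH.S x) ∘ₗ (LinearMap.mul k H).flip z) ψ)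
      (fun x x' z => by
        simp only [dualConv, map_add, LinearMap.comp_add, LinearMap.add_comp,
          TensorProduct.map_add_left])
      (fun r x z => by
        simp only [dualConv, map_smul, LinearMap.comp_smul, LinearMap.smul_comp,
          TensorProduct.map_smul_left])
      (fun x z z' => by
        simp only [dualConv, map_add, LinearMap.comp_add, LinearMap.add_comp,
          TensorProduct.map_add_left])
      (fun r x z => by
        simp only [dualConv, map_smul, LinearMap.comp_smul, LinearMap.smul_comp,
          TensorProduct.map_smul_left])))
    (LinearMap.mulRight k h) ∘ₗ
    (TensorProduct.rightComm k H H H).toLinearMap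

@[simp]
lemma dualTwistMul_tmul (φ ψ : Module.Dual k H) (h x y z : H) :
    WH.dualTwistMul φ ψ h ((x ⊗ₜ[k] y) ⊗ₜ[k] z) =
      dualConv WH.W (φ ∘ₗ LinearMap.mulLeft k (WH.S x) ∘ₗ LinearMap.mulRight k z) ψ
        ⊗ₜ[k] (y * h) := rfl

end WeakHopf

/-- Let `H` be a finitely generated projective weak Hopf algebra with bijective
antipode.  The map `f(h ⊗ h*) = h* ⊗ S⁻¹(h)` is anti-multiplicative with respect to
the smash-product multiplication
`(h ⊲⊳ h*)(g ⊲⊳ g*) = hg₍₂₎ ⊲⊳ (S⁻¹(g₍₁₎) ⇀ h* ↼ g₍₃₎) * g*` on `H ⊗ H*` and the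
multiplication `(h* ⊗ h)(g* ⊗ g) = (h₍₃₎ ⇀ g* ↼ S(h₍₁₎)) * h* ⊗ h₍₂₎g` on `H* ⊗ H`,
where `⟨a ⇀ φ ↼ b, l⟩ = φ(b l a)`.  Sweedler components are encoded by finite
representations of the iterated comultiplication. -/
theorem weakHopf_doubleFlip_antiMultiplicative
    {k H : Type*} [CommRing k] [Ring H] [Algebra k H]
    [Module.Finite k H] [Module.Projective k H]
    (WH : WeakHopf k H) (Sinv : H →ₗ[k] H)
    (hSinv₁ : ∀ h : H, Sinv (WH.S h) = h) (hSinv₂ : ∀ h : H, WH.S (Sinv h) = h)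
    (h g : H) (φ ψ : Module.Dual k H)
    {ι κ : Type*} (s : Finset ι) (t : Finset κ)
    (a b c : ι → H) (a' b' c' : κ → H)
    (hg : (WH.W.comul.rTensor H) (WH.W.comul g) = ∑ i ∈ s, (a i ⊗ₜ[k] b i) ⊗ₜ[k] c i)
    (hsg : (WH.W.comul.rTensor H) (WH.W.comul (Sinv g)) =
      ∑ j ∈ t, (a' j ⊗ₜ[k] b' j) ⊗ₜ[k] c' j) :
    doubleFlip Sinv
      (∑ i ∈ s, (h * b i) ⊗ₜ[k]
        dualConv WH.W (φ ∘ₗ LinearMap.mulLeft k (c i) ∘ₗ LinearMap.mulRight k (Sinv (a i))) ψ) =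
    ∑ j ∈ t,
      (dualConv WH.W (φ ∘ₗ LinearMap.mulLeft k (WH.S (a' j)) ∘ₗ LinearMap.mulRight k (c' j)) ψ)
        ⊗ₜ[k] (b' j * Sinv h) := by
  have e := congrArg (WH.dualTwistMul φ ψ (Sinv h))
    ((WH.rTensor_comul_comul_antipodeInv hSinv₁ hSinv₂ hg).symm.trans hsg)
  simp only [map_sum, WeakHopf.dualTwistMul_tmul, hSinv₂] at e
  rw [← e]
  simp [doubleFlip, map_sum, WH.antipodeInv_mul hSinv₁ hSinv₂]
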